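/- arXiv:2502.09807 — 2 statements merged into one kernel-verified Lean document; each statement's English description precedes it below -/
import Mathlib

section
/- Let ψ: ℕ → (0,∞) be monotonically decreasing with ψ(q) → 0 as q → ∞ and let ρ ∈ [1,∞). Then the set Exact*_n(ψ, ‖·‖, ‖·‖_ρ) has n-dimensional Lebesgue measure zero. -/
open MeasureTheory Filter Set

/-- The unit cube `[0,1]^n` in `ℝ^n` (with the maximum norm). -/
def unitCube (n : ℕ) : Set (Fin n → ℝ) := Set.univ.pi fun _ => Set.Icc (0 : ℝ) 1

/-- The `ρ`-norm `‖x‖_ρ = (Σ_i |x_i|^ρ)^{1/ρ}` on `ℝ^n`. -/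
noncomputable def rhoNorm {n : ℕ} (ρ : ℝ) (x : Fin n → ℝ) : ℝ :=
  (∑ i, |x i| ^ ρ) ^ (1 / ρ)

/-- `Exact*_n(ψ, ‖·‖, ‖·‖_ρ)`: the set of `x ∈ [0,1]^n` with `‖x - p/q‖ < ψ(q)/q`
for infinitely many `(p,q) ∈ ℤ^n × ℕ`, and `‖x - p/q‖_ρ > ψ(q)/q` for all `p ∈ ℤ^n`
and all sufficiently large `q ∈ ℕ`. -/
def ExactStar (n : ℕ) (ψ : ℕ → ℝ) (ρ : ℝ) : Set (Fin n → ℝ) :=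
  {x ∈ unitCube n |
    {pq : (Fin n → ℤ) × ℕ | 0 < pq.2 ∧
      ‖x - fun i => (pq.1 i : ℝ) / pq.2‖ < ψ pq.2 / pq.2}.Infinite ∧
    ∀ᶠ q : ℕ in atTop, ∀ p : Fin n → ℤ,
      ψ q / q < rhoNorm ρ (x - fun i => (p i : ℝ) / q)}

lemma rhoNorm_le {n : ℕ} {ρ : ℝ} (hρ : 0 < ρ) (x : Fin n → ℝ) :
    rhoNorm ρ x ≤ (n : ℝ) ^ (1 / ρ) * ‖x‖ := by
  have hsum : ∑ i, |x i| ^ ρ ≤ n * ‖x‖ ^ ρ := by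
    calc ∑ i, |x i| ^ ρ ≤ ∑ _i : Fin n, ‖x‖ ^ ρ :=
          Finset.sum_le_sum fun i _ =>
            Real.rpow_le_rpow (abs_nonneg _) (norm_le_pi_norm x i) hρ.le
      _ = n * ‖x‖ ^ ρ := by simp
  calc rhoNorm ρ x ≤ (n * ‖x‖ ^ ρ) ^ (1 / ρ) :=
        Real.rpow_le_rpow (Finset.sum_nonneg fun i _ => by positivity) hsum (by positivity)
    _ = (n : ℝ) ^ (1 / ρ) * ‖x‖ := by
        rw [Real.mul_rpow (by positivity) (by positivity), ← Real.rpow_mul (norm_nonneg _),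
          mul_one_div_cancel hρ.ne', Real.rpow_one]

/-- The points of `ℝ^n` with common denominator `q`. -/
def ratPoints (n q : ℕ) : Set (Fin n → ℝ) :=
  range fun (p : Fin n → ℤ) i => (p i : ℝ) / q

lemma mem_thickening_ratPoints {n q : ℕ} {x : Fin n → ℝ} {δ : ℝ} :
    x ∈ Metric.thickening δ (ratPoints n q) ↔
      ∃ p : Fin n → ℤ, ‖x - fun i => (p i : ℝ) / q‖ < δ := by
  simp [Metric.mem_thickening_iff, ratPoints, dist_eq_norm]

lemma finite_setOf_norm_sub_div_lt {n q : ℕ} (hq : 0 < q) (x : Fin n → ℝ) (δ : ℝ) :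
    {p : Fin n → ℤ | ‖x - fun i => (p i : ℝ) / q‖ < δ}.Finite := by
  have hq' : (0 : ℝ) < q := by exact_mod_cast hq
  refine (Set.finite_Icc (fun i => ⌊(x i - δ) * q⌋) (fun i => ⌈(x i + δ) * q⌉)).subset ?_
  intro p hp
  have key : ∀ i, (x i - δ) * q < p i ∧ (p i : ℝ) < (x i + δ) * q := by
    intro i
    have h := (norm_le_pi_norm (x - fun i => (p i : ℝ) / q) i).trans_lt hp
    rw [Pi.sub_apply, Real.norm_eq_abs, abs_lt] at h
    exact ⟨(lt_div_iff₀ hq').1 (by linarith [h.2]), (div_lt_iff₀ hq').1 (by linarith [h.1])⟩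
  refine ⟨fun i => ?_, fun i => ?_⟩
  · exact_mod_cast (Int.floor_le _).trans (key i).1.le
  · exact_mod_cast (key i).2.le.trans (Int.le_ceil _)

/-- A point with infinitely many good approximations `p / q` has them for infinitely many `q`. -/
lemma frequently_mem_thickening {n : ℕ} {r : ℕ → ℝ} {x : Fin n → ℝ}
    (h : {pq : (Fin n → ℤ) × ℕ | 0 < pq.2 ∧
      ‖x - fun i => (pq.1 i : ℝ) / pq.2‖ < r pq.2}.Infinite) :
    ∃ᶠ q in atTop, x ∈ Metric.thickening (r q) (ratPoints n q) := by
  rw [Filter.Frequently, eventually_atTop]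
  rintro ⟨N, hN⟩
  refine h (((Set.finite_Ioo 0 N).biUnion fun q hq =>
    (finite_setOf_norm_sub_div_lt hq.1 x (r q)).image fun p => (p, q)).subset ?_)
  rintro ⟨p, q⟩ ⟨hq, hp⟩
  have hqN : q < N := lt_of_not_ge fun hNq => hN q hNq (mem_thickening_ratPoints.2 ⟨p, hp⟩)
  exact mem_biUnion (show q ∈ Ioo 0 N from ⟨hq, hqN⟩) ⟨p, hp, rfl⟩

theorem stmt15 (n : ℕ) (hn : 0 < n) (ψ : ℕ → ℝ) (hψpos : ∀ q, 0 < ψ q)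
    (hψanti : Antitone ψ) (hψ0 : Tendsto ψ atTop (nhds 0))
    (ρ : ℝ) (hρ : 1 ≤ ρ) :
    volume (ExactStar n ψ ρ) = 0 := by
  set r : ℕ → ℝ := fun q => ψ q / q with hr
  set C : ℝ := (n : ℝ) ^ (1 / ρ) with hC
  have hCpos : 0 < C := Real.rpow_pos_of_pos (by exact_mod_cast hn) _
  have hr0 : Tendsto r atTop (nhds 0) := hψ0.div_atTop tendsto_natCast_atTop_atTop
  have hae := blimsup_thickening_mul_ae_eq (volume : Measure (Fin n → ℝ)) (fun _ => True)
    (ratPoints n) (inv_pos.2 hCpos) r hr0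
  refine measure_mono_null ?_ (ae_le_set.1 hae.symm.le)
  rintro x ⟨-, hinf, hev⟩
  simp only [blimsup_true, Set.mem_sdiff, mem_limsup_iff_frequently_mem]
  refine ⟨frequently_mem_thickening (r := r) hinf, not_frequently.2 ?_⟩
  filter_upwards [hev] with q hq hx
  obtain ⟨p, hp⟩ := mem_thickening_ratPoints.1 hx
  refine (hq p).not_ge ((rhoNorm_le (by linarith) _).trans ?_)
  rw [← le_inv_mul_iff₀ hCpos]
  exact hp.le
end

section
/- Let n ∈ ℕ and for each i ∈ {1,…,n} let ψ_i(q) = q^{-τ_{ψ_i}} and φ_i(q) = q^{-τ_{φ_i}} with τ_{ψ_i}, τ_{φ_i} ∈ ℝ_{>0}. If s > max_{j=1,…,n} min_{k(j)=1,…,n} { (n + 1 + Σ_{i≠j : τ_{ψ_i} < τ_{k(j)}} (τ_{k(j)} - τ_{ψ_i}) + max{0, τ_{k(j)} - τ_{ψ_j} - τ_{φ_j}}) / (1 + τ_{k(j)}) }, where τ_{k(j)} = τ_{ψ_j} + τ_{φ_j} if k(j) = j and τ_{k(j)} = τ_{ψ_{k(j)}} otherwise, then the s-dimensional Hausdorff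 measure of W_n(Ψ,Φ) is zero. -/
open MeasureTheory Filter Set

/-- `W_n(Ψ, Φ)`: the set of `x ∈ [0,1]^n` such that, for infinitely many
`(p,q) ∈ ℤ^n × ℕ`, one has `|x_i - p_i/q| < ψ_i(q)/q` for every `i` and
`|x_j - p_j/q| > (1 - φ_j(q))·ψ_j(q)/q` for some `j`. -/
def Wweighted (n : ℕ) (Ψ Φ : Fin n → ℕ → ℝ) : Set (Fin n → ℝ) :=
  {x ∈ unitCube n |
    {pq : (Fin n → ℤ) × ℕ | 0 < pq.2 ∧
      (∀ i, |x i - (pq.1 i : ℝ) / pq.2| < Ψ i pq.2 / pq.2) ∧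
      (∃ j, (1 - Φ j pq.2) * (Ψ j pq.2 / pq.2) < |x j - (pq.1 j : ℝ) / pq.2|)}.Infinite}

/-- `τ_{k(j)}`: equals `τ_{ψ_j} + τ_{φ_j}` if `k = j`, and `τ_{ψ_k}` otherwise. -/
noncomputable def tauK {n : ℕ} (τψ τφ : Fin n → ℝ) (j k : Fin n) : ℝ :=
  if k = j then τψ j + τφ j else τψ k

open scoped Classical in
/-- The quantity
`(n + 1 + Σ_{i ≠ j : τ_{ψ_i} < τ_{k(j)}}(τ_{k(j)} - τ_{ψ_i}) + max{0, τ_{k(j)} - τ_{ψ_j} - τ_{φ_j}}) / (1 + τ_{k(j)})`. -/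
noncomputable def dimExpr (n : ℕ) (τψ τφ : Fin n → ℝ) (j k : Fin n) : ℝ :=
  ((n : ℝ) + 1 +
      (∑ i ∈ Finset.univ.filter fun i => i ≠ j ∧ τψ i < tauK τψ τφ j k,
        (tauK τψ τφ j k - τψ i)) +
      max 0 (tauK τψ τφ j k - τψ j - τφ j)) /
    (1 + tauK τψ τφ j k)

open scoped ENNReal Topology

/-- Hausdorff–Cantelli lemma: if `∑ diam(t i)^s < ∞`, then the points lying in infinitely many
`t i` form an `ℋ^s`-null set. -/
theorem hausdorffMeasure_setOf_infinite_mem_eq_zero {X ι : Type*} [EMetricSpace X]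
    [MeasurableSpace X] [BorelSpace X] [Countable ι] {s : ℝ} (hs : 0 < s) (t : ι → Set X)
    (ht : ∑' i, Metric.ediam (t i) ^ s ≠ ∞) :
    μH[s] {x | {i | x ∈ t i}.Infinite} = 0 := by
  have htail := ENNReal.tendsto_tsum_compl_atTop_zero ht
  have hr : Tendsto (fun F : Finset ι => (∑' i : {i // i ∉ F}, Metric.ediam (t i) ^ s) ^ s⁻¹)
      atTop (𝓝 0) := by
    have := (ENNReal.continuous_rpow_const (y := s⁻¹)).tendsto 0 |>.comp htail
    rwa [ENNReal.zero_rpow_of_pos (inv_pos.2 hs)] at this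
  have key := Measure.hausdorffMeasure_le_liminf_tsum (β := Finset ι)
    (ι := fun F => {i // i ∉ F}) s {x | {i | x ∈ t i}.Infinite} (l := atTop) _ hr
    (fun _ i => t i)
    (Eventually.of_forall fun F i => by
      rw [ENNReal.le_rpow_inv_iff hs]
      exact ENNReal.le_tsum (f := fun i : {i // i ∉ F} => Metric.ediam (t i) ^ s) i)
    (Eventually.of_forall fun F x hx => by
      obtain ⟨i, hi, hiF⟩ := Set.Infinite.exists_notMem_finset hx F
      exact mem_iUnion.2 ⟨⟨i, hiF⟩, hi⟩)
  rw [htail.liminf_eq] at key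
  exact le_antisymm key bot_le

theorem exists_fin_mem_Icc_of_mem_Icc {a x δ c : ℝ} (hδ : 0 < δ)
    (hx : x ∈ Icc a (a + c * δ)) :
    ∃ m : Fin (⌊c⌋₊ + 1), x ∈ Icc (a + m * δ) (a + m * δ + δ) := by
  have h0 : 0 ≤ (x - a) / δ := div_nonneg (sub_nonneg.2 hx.1) hδ.le
  have hc : (x - a) / δ ≤ c := by rw [div_le_iff₀ hδ]; linarith [hx.2]
  refine ⟨⟨⌊(x - a) / δ⌋₊, Nat.lt_succ_of_le (Nat.floor_le_floor hc)⟩, ?_, ?_⟩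
  · have := Nat.floor_le h0
    rw [le_div_iff₀ hδ] at this
    simp only
    linarith
  · have := (Nat.lt_floor_add_one ((x - a) / δ)).le
    rw [div_le_iff₀ hδ] at this
    simp only
    linarith

theorem natFloor_two_mul_rpow_add_one_le {q : ℕ} (hq : 0 < q) (e : ℝ) :
    ((⌊2 * (q : ℝ) ^ e⌋₊ + 1 : ℕ) : ℝ) ≤ 3 * (q : ℝ) ^ max 0 e := by
  have hq1 : (1 : ℝ) ≤ q := by exact_mod_cast hq
  have h1 : (q : ℝ) ^ e ≤ (q : ℝ) ^ max 0 e := Real.rpow_le_rpow_of_exponent_le hq1 (le_max_right _ _)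
  have h2 : (1 : ℝ) ≤ (q : ℝ) ^ max 0 e := Real.one_le_rpow hq1 (le_max_left _ _)
  have h3 : (⌊2 * (q : ℝ) ^ e⌋₊ : ℝ) ≤ 2 * (q : ℝ) ^ e := Nat.floor_le (by positivity)
  push_cast
  linarith

/-- Index set for the cubes covering the boxes of denominator `q`: a choice of box for each
numerator vector, the numerator vector, and the position of the cube inside the box. -/
abbrev CoverIndex (n : ℕ) (ρ : Fin n → ℝ) (k : Fin n) (q : ℕ) : Type :=
  (Bool × (Fin n → Finset.Icc (-1 : ℤ) (q + 1))) ×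
    (∀ i, Fin (⌊2 * (q : ℝ) ^ (ρ k - ρ i)⌋₊ + 1))

theorem card_coverIndex_le {n : ℕ} (ρ : Fin n → ℝ) (k : Fin n) {q : ℕ} (hq : 0 < q) :
    (Fintype.card (CoverIndex n ρ k q) : ℝ) ≤
      2 * 4 ^ n * 3 ^ n * (q : ℝ) ^ (n + ∑ i, max 0 (ρ k - ρ i)) := by
  have hq1 : (1 : ℝ) ≤ q := by exact_mod_cast hq
  have hq0 : (0 : ℝ) < q := by linarith
  have hcard : Fintype.card (CoverIndex n ρ k q) =
      2 * (q + 3) ^ n * ∏ i, (⌊2 * (q : ℝ) ^ (ρ k - ρ i)⌋₊ + 1) := by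
    have : ((q : ℤ) + 1 + 1 + 1).toNat = q + 3 := by omega
    simp [CoverIndex, this]
  have h1 : (∏ i, ((⌊2 * (q : ℝ) ^ (ρ k - ρ i)⌋₊ + 1 : ℕ) : ℝ)) ≤
      3 ^ n * (q : ℝ) ^ (∑ i, max 0 (ρ k - ρ i)) := by
    rw [Real.rpow_sum_of_pos hq0]
    calc _ ≤ ∏ i, (3 * (q : ℝ) ^ max 0 (ρ k - ρ i)) :=
          Finset.prod_le_prod (fun _ _ => by positivity)
            fun i _ => natFloor_two_mul_rpow_add_one_le hq _
      _ = _ := by simp [Finset.prod_mul_distrib]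
  have h2 : ((q : ℝ) + 3) ^ n ≤ 4 ^ n * (q : ℝ) ^ n := by
    rw [← mul_pow]
    gcongr
    linarith
  rw [hcard, Real.rpow_add hq0, Real.rpow_natCast]
  calc ((2 * (q + 3) ^ n * ∏ i, (⌊2 * (q : ℝ) ^ (ρ k - ρ i)⌋₊ + 1) : ℕ) : ℝ)
      = 2 * ((q : ℝ) + 3) ^ n * ∏ i, ((⌊2 * (q : ℝ) ^ (ρ k - ρ i)⌋₊ + 1 : ℕ) : ℝ) := by
        push_cast; ring
    _ ≤ 2 * (4 ^ n * (q : ℝ) ^ n) * (3 ^ n * (q : ℝ) ^ (∑ i, max 0 (ρ k - ρ i))) := by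
        gcongr
    _ = _ := by ring

theorem ediam_pi_Icc_add_le {ι : Type*} [Fintype ι] (c : ι → ℝ) (δ : ℝ) :
    Metric.ediam (Set.univ.pi fun i => Icc (c i) (c i + δ)) ≤ ENNReal.ofReal δ := by
  refine Metric.ediam_le fun x hx y hy => edist_pi_le_iff.2 fun i => ?_
  rw [edist_dist, Real.dist_eq]
  have hxi := hx i trivial
  have hyi := hy i trivial
  exact ENNReal.ofReal_le_ofReal (abs_le.2 ⟨by linarith [hxi.1, hyi.2], by linarith [hxi.2, hyi.1]⟩)

/-- Points lying, for infinitely many rationals `p / q`, in one of two boxes attached to `p / q`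
with side lengths `2 q^{-1-ρ_i}`, form an `ℋ^s`-null set, as soon as `s` exceeds the exponent
given by covering these boxes with cubes of side length `q^{-1-ρ_k}`. -/
theorem hausdorffMeasure_infinite_boxes_eq_zero {n : ℕ} (ρ : Fin n → ℝ) (hρ : ∀ i, 0 < ρ i)
    (k : Fin n) {s : ℝ} (hs : (n + 1 + ∑ i, max 0 (ρ k - ρ i)) / (1 + ρ k) < s)
    (a : Bool → (Fin n → ℤ) → ℕ → Fin n → ℝ) :
    μH[s] {x : Fin n → ℝ | {pq : (Fin n → ℤ) × ℕ | 0 < pq.2 ∧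
      (∀ i, pq.1 i ∈ Finset.Icc (-1 : ℤ) (pq.2 + 1)) ∧
      ∃ b, ∀ i, x i ∈ Icc (a b pq.1 pq.2 i)
        (a b pq.1 pq.2 i + 2 * (pq.2 : ℝ) ^ (-1 - ρ i))}.Infinite} = 0 := by
  have hk := hρ k
  have hE : 0 ≤ ∑ i, max 0 (ρ k - ρ i) := Finset.sum_nonneg fun _ _ => le_max_left _ _
  have hs0 : 0 < s := lt_of_le_of_lt (by positivity) hs
  rw [div_lt_iff₀ (by linarith)] at hs
  let t : (Σ q, CoverIndex n ρ k q) → Set (Fin n → ℝ) := fun z =>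
    Set.univ.pi fun i =>
      Icc (a z.2.1.1 (fun i => z.2.1.2 i) z.1 i + (z.2.2 i : ℕ) * (z.1 : ℝ) ^ (-1 - ρ k))
        (a z.2.1.1 (fun i => z.2.1.2 i) z.1 i + (z.2.2 i : ℕ) * (z.1 : ℝ) ^ (-1 - ρ k) +
          (z.1 : ℝ) ^ (-1 - ρ k))
  have hsum : ∑' z, Metric.ediam (t z) ^ s ≠ ∞ := by
    set e : ℝ := n + ∑ i, max 0 (ρ k - ρ i) + (-1 - ρ k) * s with he
    have hlt : e < -1 := by linarith
    have hbound : ∀ q : ℕ, ∑' z : CoverIndex n ρ k q, Metric.ediam (t ⟨q, z⟩) ^ s ≤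
        ENNReal.ofReal (2 * 4 ^ n * 3 ^ n * (q : ℝ) ^ e) := by
      intro q
      calc ∑' z : CoverIndex n ρ k q, Metric.ediam (t ⟨q, z⟩) ^ s
          ≤ ∑' _ : CoverIndex n ρ k q, ENNReal.ofReal ((q : ℝ) ^ ((-1 - ρ k) * s)) := by
            refine ENNReal.tsum_le_tsum fun z => ?_
            rw [Real.rpow_mul (by positivity), ← ENNReal.ofReal_rpow_of_nonneg (by positivity) hs0.le]
            exact ENNReal.rpow_le_rpow (ediam_pi_Icc_add_le _ _) hs0.le
        _ = ENNReal.ofReal (Fintype.card (CoverIndex n ρ k q) * (q : ℝ) ^ ((-1 - ρ k) * s)) := by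
            rw [tsum_fintype, Finset.sum_const, nsmul_eq_mul, Finset.card_univ,
              ENNReal.ofReal_mul (by positivity), ENNReal.ofReal_natCast]
        _ ≤ _ := by
            refine ENNReal.ofReal_le_ofReal ?_
            rcases Nat.eq_zero_or_pos q with rfl | hq
            · have : (-1 - ρ k) * s ≠ 0 := (mul_neg_of_neg_of_pos (by linarith) hs0).ne
              simp only [Nat.cast_zero, Real.zero_rpow this, mul_zero]
              positivity
            · rw [he, Real.rpow_add (by exact_mod_cast hq), ← mul_assoc]
              gcongr
              exact card_coverIndex_le ρ k hq
    rw [ENNReal.tsum_sigma']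
    refine ne_top_of_le_ne_top ?_ (ENNReal.tsum_le_tsum hbound)
    exact ((Real.summable_nat_rpow.2 hlt).mul_left _).tsum_ofReal_ne_top
  refine measure_mono_null (fun x hx => ?_)
    (hausdorffMeasure_setOf_infinite_mem_eq_zero hs0 t hsum)
  refine Infinite.of_image (fun z => ((fun i => (z.2.1.2 i : ℤ)), z.1)) (hx.mono ?_)
  rintro ⟨p, q⟩ ⟨hq, hp, b, hb⟩
  simp only at hq hp hb
  have hq0 : (0 : ℝ) < q := by exact_mod_cast hq
  have hex : ∀ i, ∃ m : Fin (⌊2 * (q : ℝ) ^ (ρ k - ρ i)⌋₊ + 1),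
      x i ∈ Icc (a b p q i + m * (q : ℝ) ^ (-1 - ρ k))
        (a b p q i + m * (q : ℝ) ^ (-1 - ρ k) + (q : ℝ) ^ (-1 - ρ k)) := fun i => by
    refine exists_fin_mem_Icc_of_mem_Icc (by positivity) ?_
    rw [mul_assoc, ← Real.rpow_add hq0]
    convert hb i using 5
    ring
  choose m hm using hex
  exact ⟨⟨q, ⟨b, fun i => ⟨p i, hp i⟩⟩, m⟩, fun i _ => hm i, rfl⟩

theorem dimExpr_eq {n : ℕ} (τψ τφ : Fin n → ℝ) (j k : Fin n) :
    dimExpr n τψ τφ j k = (n + 1 +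
      ∑ i, max 0 (tauK τψ τφ j k - tauK τψ τφ j i)) / (1 + tauK τψ τφ j k) := by
  classical
  unfold dimExpr
  congr 1
  rw [← Finset.add_sum_erase _ _ (Finset.mem_univ j), add_assoc, add_comm (Finset.sum _ _)]
  congr 2
  · simp [tauK, sub_sub]
  · rw [← Finset.filter_ne', ← Finset.filter_filter, Finset.sum_filter]
    refine Finset.sum_congr rfl fun i hi => ?_
    rw [tauK, tauK, if_neg (Finset.mem_filter.1 hi).2]
    split_ifs with h1 h2 <;> grind

theorem mem_Icc_neg_one_of_abs_sub_div_lt {x : ℝ} (hx : x ∈ Icc (0 : ℝ) 1) {p : ℤ} {q : ℕ}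
    (hq : 0 < q) (h : |x - p / q| < 1 / q) : p ∈ Finset.Icc (-1 : ℤ) (q + 1) := by
  have hq0 : (0 : ℝ) < q := by exact_mod_cast hq
  have h' : |x * q - p| < 1 := by
    have : x * q - p = (x - p / q) * q := by field_simp
    rw [this, abs_mul, abs_of_pos hq0]
    rwa [lt_div_iff₀ hq0] at h
  obtain ⟨h1, h2⟩ := abs_lt.1 h'
  have h3 : (-1 : ℝ) < p := by nlinarith [hx.1]
  have h4 : (p : ℝ) < q + 1 := by nlinarith [hx.2]
  rw [Finset.mem_Icc]
  constructor
  · exact_mod_cast h3.le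
  · exact_mod_cast h4.le

theorem stmt17 (n : ℕ) (hn : 0 < n) (τψ τφ : Fin n → ℝ)
    (hτψ : ∀ i, 0 < τψ i) (hτφ : ∀ i, 0 < τφ i)
    (s : ℝ) (hs : (⨆ j, ⨅ k, dimExpr n τψ τφ j k) < s) :
    μH[s] (Wweighted n (fun i q => (q : ℝ) ^ (-(τψ i))) (fun i q => (q : ℝ) ^ (-(τφ i)))) = 0 := by
  have : Nonempty (Fin n) := ⟨⟨0, hn⟩⟩
  have hk : ∀ j, ∃ k, dimExpr n τψ τφ j k < s := fun j =>
    exists_lt_of_ciInf_lt ((le_ciSup (Finite.bddAbove_range fun j => ⨅ k, dimExpr n τψ τφ j k) j).trans_lt hs)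
  choose k hk using hk
  have hρ : ∀ j i, 0 < tauK τψ τφ j i := fun j i => by
    unfold tauK
    split_ifs
    · exact add_pos (hτψ j) (hτφ j)
    · exact hτψ i
  let a : Fin n → Bool → (Fin n → ℤ) → ℕ → Fin n → ℝ := fun j b p q i =>
    if i = j ∧ b then p i / q + (1 - (q : ℝ) ^ (-τφ j)) * ((q : ℝ) ^ (-τψ j) / q)
    else p i / q - (q : ℝ) ^ (-τψ i) / q
  refine measure_mono_null (fun x hx => ?_) (measure_iUnion_null fun j =>
    hausdorffMeasure_infinite_boxes_eq_zero (tauK τψ τφ j) (hρ j) (k j)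
      (dimExpr_eq τψ τφ j (k j) ▸ hk j) (a j))
  obtain ⟨hcube, hinf⟩ := hx
  simp only [mem_iUnion, mem_ofPred_eq]
  by_contra! hfin
  refine hinf ((finite_iUnion fun j => hfin j).subset ?_)
  rintro ⟨p, q⟩ ⟨hq, hlt, j, hj⟩
  simp only at hq hlt hj
  have hq0 : (0 : ℝ) < q := by exact_mod_cast hq
  have hq1 : (1 : ℝ) ≤ q := by exact_mod_cast hq
  have hdiv : ∀ u : ℝ, (q : ℝ) ^ (-1 - u) = (q : ℝ) ^ (-u) / q := fun u => by
    rw [show -1 - u = -u - 1 by ring, Real.rpow_sub_one hq0.ne']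
  refine mem_iUnion.2 ⟨j, hq, fun i => ?_, ?_⟩
  · refine mem_Icc_neg_one_of_abs_sub_div_lt (hcube i trivial) hq ((hlt i).trans_le ?_)
    gcongr
    exact Real.rpow_le_one_of_one_le_of_nonpos hq1 (by linarith [hτψ i])
  · have hprod : (q : ℝ) ^ (-1 - (τψ j + τφ j)) = (q : ℝ) ^ (-τφ j) * ((q : ℝ) ^ (-τψ j) / q) := by
      rw [hdiv, neg_add, Real.rpow_add hq0]
      ring
    have hwidth : 0 < (q : ℝ) ^ (-1 - (τψ j + τφ j)) := by positivity
    have hsign : ∃ b : Bool, x j ∈ Icc (a j b p q j)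
        (a j b p q j + 2 * (q : ℝ) ^ (-1 - (τψ j + τφ j))) := by
      have hlt' := abs_lt.1 (hlt j)
      rcases lt_abs.1 hj with h | h
      · refine ⟨true, ?_⟩
        simp only [a, and_self, if_true]
        constructor <;> linarith [hlt'.1, hlt'.2]
      · refine ⟨false, ?_⟩
        simp only [a, Bool.false_eq_true, and_false, if_false]
        constructor <;> linarith [hlt'.1, hlt'.2]
    obtain ⟨b, hb⟩ := hsign
    refine ⟨b, fun i => ?_⟩
    by_cases hij : i = j
    · subst hij
      simpa [tauK] using hb
    · have hlt' := abs_lt.1 (hlt i)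
      simp only [a, tauK, hij, false_and, if_false, hdiv]
      constructor <;> linarith [hlt'.1, hlt'.2]
end
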